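/- arXiv:1605.05516 — 2 statements merged into one kernel-verified Lean document; each statement's English description precedes it below -/
import Mathlib

section
/- Let n ≥ 1 and 0 ≤ k ≤ n. Let A be a finite set, and for each a ∈ A let r(a) ∈ {0,…,n} and let χ(a) = (χ₁(a),…,χₙ(a)) be a vector of positive real numbers. For α ∈ ℕⁿ define the multiplicity m_{k,a}(α) := #{(I,J) : I ⊆ {1,…,r(a)}, J ⊆ {r(a)+1,…,n}, (|J| : ℤ) − (|I| : ℤ) = k − r(a), and α_j ≥ 1 for every j ∈ I ∪ J}. Then, as Λ → +∞, ∑_{a∈A} ∑_{α ∈ ℕⁿ : ∑_j α_j χ_j(a) ≤ Λ} m_{k,a}(α) = (Λⁿ / (k!·(n−k)!)) · ∑_{a∈A} (∏_{j=1}^n χ_j(a))^{-1} + O(Λ^{n−1}). -/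
/-- The lattice points of the simplex `{x ≥ 0 : ∑ j, x j * χ j ≤ Λ}`. -/
def simplexLattice {n : ℕ} (χ : Fin n → ℝ) (Λ : ℝ) : Set (Fin n → ℕ) :=
  {α | ∑ j, (α j : ℝ) * χ j ≤ Λ}

namespace simplexLattice

lemma finite {n : ℕ} {χ : Fin n → ℝ} (hχ : ∀ j, 0 < χ j) (Λ : ℝ) :
    (simplexLattice χ Λ).Finite := by
  refine (Set.finite_Iic (fun j => ⌊Λ / χ j⌋₊)).subset fun α hα j => ?_
  apply Nat.le_floor
  rw [le_div_iff₀ (hχ j)]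
  exact (Finset.single_le_sum (f := fun j => (α j : ℝ) * χ j)
    (fun i _ => mul_nonneg (Nat.cast_nonneg _) (hχ i).le) (Finset.mem_univ j)).trans hα

lemma eq_empty {n : ℕ} {χ : Fin n → ℝ} (hχ : ∀ j, 0 < χ j) {Λ : ℝ} (hΛ : Λ < 0) :
    simplexLattice χ Λ = ∅ := by
  refine Set.eq_empty_of_forall_notMem fun α hα => hΛ.not_ge (le_trans ?_ hα)
  exact Finset.sum_nonneg fun i _ => mul_nonneg (Nat.cast_nonneg _) (hχ i).le

lemma ncard_zero (χ : Fin 0 → ℝ) {Λ : ℝ} (hΛ : 0 ≤ Λ) : (simplexLattice χ Λ).ncard = 1 := by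
  have : simplexLattice χ Λ = Set.univ := by
    ext α
    simpa [simplexLattice] using hΛ
  rw [this, Set.ncard_univ, Nat.card_unique]

/-- Splitting off the lattice points with vanishing zeroth coordinate. -/
lemma ncard_succ {n : ℕ} {χ : Fin (n + 1) → ℝ} (hχ : ∀ j, 0 < χ j) (Λ : ℝ) :
    (simplexLattice χ Λ).ncard =
      (simplexLattice (Fin.tail χ) Λ).ncard + (simplexLattice χ (Λ - χ 0)).ncard := by
  have hinj₀ : Function.Injective (fun α : Fin n → ℕ => (Fin.cons 0 α : Fin (n + 1) → ℕ)) :=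
    Fin.cons_right_injective (α := fun _ => ℕ) 0
  have hinj₁ : Function.Injective (fun α : Fin (n + 1) → ℕ => α + Pi.single 0 1) :=
    add_left_injective _
  have hfin : (simplexLattice (Fin.tail χ) Λ).Finite := finite (fun j => hχ j.succ) Λ
  rw [← Set.ncard_image_of_injective _ hinj₀,
    ← Set.ncard_image_of_injective (simplexLattice χ (Λ - χ 0)) hinj₁,
    ← Set.ncard_union_eq _ (hfin.image _) ((finite hχ _).image _)]
  · congr 1
    ext α
    constructor
    · intro hα
      have hα' : ∑ j, (α j : ℝ) * χ j ≤ Λ := hα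
      rw [Fin.sum_univ_succ] at hα'
      by_cases h0 : α 0 = 0
      · left
        refine ⟨Fin.tail α, ?_, ?_⟩
        · simpa [simplexLattice, Fin.tail, h0] using hα'
        · simp only [← h0, Fin.cons_self_tail]
      · right
        refine ⟨α - Pi.single 0 1, ?_, ?_⟩
        · have h1 : 1 ≤ α 0 := Nat.one_le_iff_ne_zero.mpr h0
          simp only [simplexLattice, Set.mem_ofPred_eq, Fin.sum_univ_succ, Pi.sub_apply]
          simp only [Pi.single_eq_same, ne_eq, Fin.succ_ne_zero, not_false_eq_true,
            Pi.single_eq_of_ne, tsub_zero, Nat.cast_sub h1, Nat.cast_one]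
          linarith
        · ext j
          refine Fin.cases ?_ (fun j => ?_) j
          · simp only [Pi.add_apply, Pi.sub_apply, Pi.single_eq_same]
            omega
          · simp
    · rintro (⟨β, hβ, rfl⟩ | ⟨β, hβ, rfl⟩)
      · simpa [simplexLattice, Fin.sum_univ_succ, Fin.tail] using hβ
      · have hβ' : ∑ j, (β j : ℝ) * χ j ≤ Λ - χ 0 := hβ
        rw [Fin.sum_univ_succ] at hβ'
        simp only [simplexLattice, Set.mem_ofPred_eq, Fin.sum_univ_succ, Pi.add_apply]
        simp only [Pi.single_eq_same, ne_eq, Fin.succ_ne_zero, not_false_eq_true,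
            Pi.single_eq_of_ne, add_zero, Nat.cast_add, Nat.cast_one]
        linarith
  · rw [Set.disjoint_left]
    rintro _ ⟨β, -, rfl⟩ ⟨γ, -, h⟩
    have := congrFun h 0
    simp at this

/-- Induction on `Λ` in steps of size `h`, starting below `0`. -/
lemma step_induction {h : ℝ} (hh : 0 < h) {p : ℝ → Prop} (neg : ∀ Λ < 0, p Λ)
    (step : ∀ Λ, 0 ≤ Λ → p (Λ - h) → p Λ) (Λ : ℝ) : p Λ := by
  have key : ∀ (N : ℕ) (Λ : ℝ), Λ < N * h → p Λ := by
    intro N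
    induction N with
    | zero => intro Λ hΛ; exact neg Λ (by simpa using hΛ)
    | succ N ih =>
      intro Λ hΛ
      rcases lt_or_ge Λ 0 with h0 | h0
      · exact neg Λ h0
      · refine step Λ h0 (ih _ ?_)
        push_cast at hΛ
        linarith
  obtain ⟨N, hN⟩ := exists_nat_gt (Λ / h)
  exact key N Λ ((div_lt_iff₀ hh).mp hN)

lemma pow_succ_add_le {x h : ℝ} (hx : 0 ≤ x) (hh : 0 ≤ h) (n : ℕ) :
    (n + 1) * h * x ^ n + x ^ (n + 1) ≤ (x + h) ^ (n + 1) := by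
  induction n with
  | zero => simp [add_comm]
  | succ n ih =>
    have h1 := mul_le_mul_of_nonneg_left ih (add_nonneg hx hh)
    have h2 : 0 ≤ (n + 1) * h * h * x ^ n := by positivity
    rw [pow_succ' (x + h)]
    refine le_trans ?_ h1
    push_cast
    ring_nf at h2 ⊢
    linarith

lemma add_pow_succ_le {x h : ℝ} (hx : 0 ≤ x) (hh : 0 ≤ h) (n : ℕ) :
    (x + h) ^ (n + 1) ≤ (n + 1) * h * (x + h) ^ n + x ^ (n + 1) := by
  induction n with
  | zero => simp [add_comm]
  | succ n ih =>
    have h1 := mul_le_mul_of_nonneg_left ih (add_nonneg hx hh)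
    have h2 : h * x ^ (n + 1) ≤ h * (x + h) ^ (n + 1) := by gcongr; linarith
    rw [pow_succ' (x + h) (n + 1)]
    refine h1.trans ?_
    have e1 : (x + h) * ((n + 1) * h * (x + h) ^ n + x ^ (n + 1)) =
      (n + 1) * h * (x + h) ^ (n + 1) + x ^ (n + 2) + h * x ^ (n + 1) := by ring
    rw [e1]
    push_cast
    linarith

lemma ncard_le {n : ℕ} {χ : Fin n → ℝ} (hχ : ∀ j, 0 < χ j) {Λ : ℝ} (hΛ : 0 ≤ Λ) :
    n.factorial * (∏ j, χ j) * (simplexLattice χ Λ).ncard ≤ (Λ + ∑ j, χ j) ^ n := by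
  induction n generalizing Λ with
  | zero => simp [ncard_zero χ hΛ]
  | succ n ih =>
    have hS : 0 ≤ ∑ j, Fin.tail χ j := Finset.sum_nonneg fun j _ => (hχ j.succ).le
    revert hΛ
    induction Λ using step_induction (hχ 0) with
    | neg Λ h => exact fun h' => absurd h h'.not_gt
    | step Λ hΛ hp =>
    intro _
    have h1 := ih (χ := Fin.tail χ) (fun j => hχ j.succ) hΛ
    have hx : 0 ≤ Λ + ∑ j, Fin.tail χ j := by positivity
    have h2 : ((n + 1).factorial : ℝ) * (∏ j, χ j) * (simplexLattice χ (Λ - χ 0)).ncard ≤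
        (Λ + ∑ j, Fin.tail χ j) ^ (n + 1) := by
      rcases lt_or_ge (Λ - χ 0) 0 with h0 | h0
      · simp only [eq_empty hχ h0, Set.ncard_empty, Nat.cast_zero, mul_zero]
        positivity
      · refine (hp h0).trans (le_of_eq ?_)
        rw [Fin.sum_univ_succ]
        simp only [Fin.tail]
        ring
    have h3 := pow_succ_add_le hx (hχ 0).le n
    have h4 := mul_le_mul_of_nonneg_left h1 (mul_nonneg (n.cast_add_one_pos (α := ℝ)).le (hχ 0).le)
    have e : Λ + ∑ j, χ j = Λ + ∑ j, Fin.tail χ j + χ 0 := by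
      rw [Fin.sum_univ_succ]
      simp only [Fin.tail]
      ring
    rw [e]
    refine le_trans ?_ h3
    refine le_trans (le_of_eq ?_) (add_le_add h4 h2)
    rw [ncard_succ hχ Λ, Fin.prod_univ_succ, Nat.factorial_succ]
    simp only [Fin.tail]
    push_cast
    ring

lemma le_ncard {n : ℕ} {χ : Fin n → ℝ} (hχ : ∀ j, 0 < χ j) {Λ : ℝ} (hΛ : 0 ≤ Λ) :
    Λ ^ n ≤ n.factorial * (∏ j, χ j) * (simplexLattice χ Λ).ncard := by
  induction n generalizing Λ with
  | zero => simp [ncard_zero χ hΛ]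
  | succ n ih =>
    revert hΛ
    induction Λ using step_induction (hχ 0) with
    | neg Λ h => exact fun h' => absurd h h'.not_gt
    | step Λ hΛ hp =>
    intro _
    have h1 := ih (χ := Fin.tail χ) (fun j => hχ j.succ) hΛ
    have h4 := mul_le_mul_of_nonneg_left h1 (mul_nonneg (n.cast_add_one_pos (α := ℝ)).le (hχ 0).le)
    have h5 : Λ ^ (n + 1) ≤ (n + 1) * χ 0 * Λ ^ n +
        (n + 1).factorial * (∏ j, χ j) * (simplexLattice χ (Λ - χ 0)).ncard := by
      rcases lt_or_ge (Λ - χ 0) 0 with h0 | h0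
      · simp only [eq_empty hχ h0, Set.ncard_empty, Nat.cast_zero, mul_zero, add_zero]
        rw [pow_succ']
        gcongr
        have : 0 ≤ (n : ℝ) * χ 0 := mul_nonneg n.cast_nonneg (hχ 0).le
        linarith
      · have h3 := add_pow_succ_le h0 (hχ 0).le n
        rw [sub_add_cancel] at h3
        exact h3.trans (add_le_add_right (hp h0) _)
    refine h5.trans ((add_le_add_left h4 _).trans (le_of_eq ?_))
    rw [ncard_succ hχ Λ, Fin.prod_univ_succ, Nat.factorial_succ]
    simp only [Fin.tail]
    push_cast
    ring

lemma ncard_pos {n : ℕ} (χ : Fin n → ℝ) (Λ : ℝ) :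
    {α ∈ simplexLattice χ Λ | ∀ j, 1 ≤ α j}.ncard =
      (simplexLattice χ (Λ - ∑ j, χ j)).ncard := by
  rw [← Set.ncard_image_of_injective (simplexLattice χ (Λ - ∑ j, χ j))
    (add_left_injective (1 : Fin n → ℕ))]
  congr 1
  ext α
  constructor
  · rintro ⟨hα, h1⟩
    refine ⟨α - 1, ?_, tsub_add_cancel_of_le h1⟩
    have hα' : ∑ j, (α j : ℝ) * χ j ≤ Λ := hα
    simp only [simplexLattice, Set.mem_ofPred_eq, Pi.sub_apply, Pi.one_apply]
    simp only [Nat.cast_sub (h1 _), Nat.cast_one, sub_mul, one_mul, Finset.sum_sub_distrib]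
    linarith
  · rintro ⟨β, hβ, rfl⟩
    have hβ' : ∑ j, (β j : ℝ) * χ j ≤ Λ - ∑ j, χ j := hβ
    refine ⟨?_, fun j => by simp⟩
    simp only [simplexLattice, Set.mem_ofPred_eq, Pi.add_apply, Pi.one_apply, Nat.cast_add,
      Nat.cast_one, add_mul, one_mul, Finset.sum_add_distrib]
    linarith

/-- A lattice sum over the simplex of a weight bounded by `c`, and equal to `c` on the points with
positive coordinates, is `c` times the volume up to an error of lower order. -/
lemma exists_abs_tsum_sub_le {n : ℕ} {χ : Fin n → ℝ} (hχ : ∀ j, 0 < χ j) (w : (Fin n → ℕ) → ℕ)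
    (c : ℕ) (hle : ∀ α, w α ≤ c) (heq : ∀ α, (∀ j, 1 ≤ α j) → w α = c) :
    ∃ C : ℝ, 0 ≤ C ∧ ∀ Λ : ℝ, ∑ j, χ j ≤ Λ →
      |(∑' α : Fin n → ℕ, if ∑ j, (α j : ℝ) * χ j ≤ Λ then (w α : ℝ) else 0)
        - c * Λ ^ n / n.factorial * (∏ j, χ j)⁻¹| ≤ C * Λ ^ (n - 1) := by
  set S := ∑ j, χ j with hS_def
  set V : ℝ := n.factorial * ∏ j, χ j with hV_def
  have hS : 0 ≤ S := Finset.sum_nonneg fun j _ => (hχ j).le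
  have hV : 0 < V := mul_pos (by positivity) (Finset.prod_pos fun j _ => hχ j)
  refine ⟨c / V * (S * n * 2 ^ (n - 1)), by positivity, fun Λ hΛ => ?_⟩
  have hΛ0 : 0 ≤ Λ := hS.trans hΛ
  have hfin := finite hχ Λ
  set X : ℝ := ∑' α : Fin n → ℕ, if ∑ j, (α j : ℝ) * χ j ≤ Λ then (w α : ℝ) else 0 with hX_def
  have hX : X = ∑ α ∈ hfin.toFinset, (w α : ℝ) := by
    rw [hX_def, tsum_eq_sum (s := hfin.toFinset)]
    · refine Finset.sum_congr rfl fun α hα => if_pos ?_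
      simpa [simplexLattice] using hα
    · intro α hα
      refine if_neg ?_
      simpa [simplexLattice] using hα
  have hup : X ≤ c * (simplexLattice χ Λ).ncard := by
    rw [hX, Set.ncard_eq_toFinset_card _ hfin, mul_comm, ← nsmul_eq_mul]
    exact Finset.sum_le_card_nsmul _ _ _ fun α _ => by exact_mod_cast hle α
  have hlow : c * (simplexLattice χ (Λ - S)).ncard ≤ X := by
    have hfin' := hfin.subset (Set.sep_subset (simplexLattice χ Λ) fun α => ∀ j, 1 ≤ α j)
    rw [← ncard_pos, Set.ncard_eq_toFinset_card _ hfin', mul_comm, ← nsmul_eq_mul, hX]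
    have hsub : hfin'.toFinset ⊆ hfin.toFinset := by
      intro α hα
      rw [Set.Finite.mem_toFinset] at hα ⊢
      exact hα.1
    refine le_trans ?_ (Finset.sum_le_sum_of_subset_of_nonneg hsub fun _ _ _ => Nat.cast_nonneg _)
    refine Finset.card_nsmul_le_sum _ _ _ fun α hα => ?_
    rw [Set.Finite.mem_toFinset] at hα
    rw [heq α hα.2]
  have hup' : X ≤ c / V * (Λ + S) ^ n := by
    refine hup.trans ?_
    rw [div_mul_eq_mul_div, le_div_iff₀ hV, mul_assoc]
    gcongr
    rw [mul_comm]
    exact ncard_le hχ hΛ0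
  have hlow' : c / V * (Λ - S) ^ n ≤ X := by
    refine le_trans ?_ hlow
    rw [div_mul_eq_mul_div, div_le_iff₀ hV, mul_assoc]
    gcongr
    rw [mul_comm]
    exact le_ncard hχ (sub_nonneg.mpr hΛ)
  have hmain : c * Λ ^ n / n.factorial * (∏ j, χ j)⁻¹ = c / V * Λ ^ n := by
    rw [hV_def]
    field_simp
  have hpow : ∀ y, 0 ≤ y → y ≤ 2 * Λ → |y - Λ| = S →
      |y ^ n - Λ ^ n| ≤ S * n * 2 ^ (n - 1) * Λ ^ (n - 1) := by
    intro y hy hy2 hyS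
    refine (abs_pow_sub_pow_le y Λ n).trans ?_
    rw [hyS, mul_assoc (S * n), ← mul_pow, abs_of_nonneg hy, abs_of_nonneg hΛ0]
    gcongr
    exact max_le hy2 (by linarith)
  have hp := (abs_le.mp (hpow (Λ + S) (by linarith) (by linarith)
    (by rw [add_sub_cancel_left, abs_of_nonneg hS]))).2
  have hm := (abs_le.mp (hpow (Λ - S) (by linarith) (by linarith)
    (by rw [sub_sub_cancel_left, abs_neg, abs_of_nonneg hS]))).1
  have hcV : 0 ≤ c / V := by positivity
  have hp' := mul_le_mul_of_nonneg_left hp hcV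
  have hm' := mul_le_mul_of_nonneg_left hm hcV
  rw [hmain, mul_assoc (c / V), abs_le]
  constructor <;> linarith

end simplexLattice

/-- The index pairs `(I, J)` that contribute to the multiplicity of a resonance with positive
coordinates, in bijection with the `k`-subsets through `(I, J) ↦ ({j < r} \ I) ∪ J`. -/
lemma card_index_pairs {n k r : ℕ} (hr : r ≤ n) :
    Nat.card {p : Finset (Fin n) × Finset (Fin n) |
        (∀ j ∈ p.1, (j : ℕ) < r) ∧ (∀ j ∈ p.2, r ≤ (j : ℕ)) ∧
        (p.2.card : ℤ) - (p.1.card : ℤ) = (k : ℤ) - (r : ℤ)} = n.choose k := by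
  classical
  set L : Finset (Fin n) := Finset.univ.filter fun j => (j : ℕ) < r with hL_def
  have hL : L.card = r := by
    rw [hL_def, Fin.card_filter_val_lt, min_eq_right hr]
  have hmem : ∀ j, j ∈ L ↔ (j : ℕ) < r := by simp [hL_def]
  rw [Nat.card_coe_set_eq, Set.ncard_eq_toFinset_card']
  have hchoose : n.choose k = (Finset.powersetCard k (Finset.univ : Finset (Fin n))).card := by
    simp
  rw [hchoose]
  refine Finset.card_bij' (fun p _ => (L \ p.1) ∪ p.2) (fun K _ => (L \ K, K \ L)) ?_ ?_ ?_ ?_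
  · rintro ⟨I, J⟩ hp
    obtain ⟨hI, hJ, hc⟩ : (∀ j ∈ I, (j : ℕ) < r) ∧ (∀ j ∈ J, r ≤ (j : ℕ)) ∧
        (J.card : ℤ) - (I.card : ℤ) = (k : ℤ) - (r : ℤ) := by simpa using hp
    have hIL : I ⊆ L := fun j hj => (hmem j).mpr (hI j hj)
    have hdisj : Disjoint (L \ I) J := by
      rw [Finset.disjoint_left]
      intro j hj hj'
      have := (hmem j).mp (Finset.mem_sdiff.mp hj).1
      have := hJ j hj'
      omega
    rw [Finset.mem_powersetCard]
    refine ⟨Finset.subset_univ _, ?_⟩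
    have h1 := Finset.card_sdiff_add_card_eq_card hIL
    rw [Finset.card_union_of_disjoint hdisj]
    omega
  · intro K hK
    have hK' := (Finset.mem_powersetCard.mp hK).2
    rw [Set.mem_toFinset]
    refine ⟨fun j hj => (hmem j).mp (Finset.mem_sdiff.mp hj).1, fun j hj => ?_, ?_⟩
    · exact not_lt.mp fun h => (Finset.mem_sdiff.mp hj).2 ((hmem j).mpr h)
    · have h1 := Finset.card_sdiff_add_card_inter L K
      have h2 := Finset.card_sdiff_add_card_inter K L
      rw [Finset.inter_comm] at h2
      simp only
      omega
  · rintro ⟨I, J⟩ hp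
    obtain ⟨hI, hJ, -⟩ : (∀ j ∈ I, (j : ℕ) < r) ∧ (∀ j ∈ J, r ≤ (j : ℕ)) ∧
        (J.card : ℤ) - (I.card : ℤ) = (k : ℤ) - (r : ℤ) := by simpa using hp
    have hI' : ∀ j ∈ I, j ∈ L := fun j hj => (hmem j).mpr (hI j hj)
    have hJ' : ∀ j ∈ J, j ∉ L := fun j hj h => ((hmem j).mp h).not_ge (hJ j hj)
    clear_value L
    refine Prod.ext ?_ ?_ <;> ext j <;> simp only [Finset.mem_sdiff, Finset.mem_union]
    · grind
    · grind
  · intro K _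
    clear_value L
    ext j
    simp only [Finset.mem_sdiff, Finset.mem_union]
    grind

/-- **Weyl law for Morse–Smale gradient flows (combinatorial form).**
`A` plays the role of the set of critical points, `r a` the Morse index of `a`,
`χ a j` the absolute values of the Lyapunov exponents at `a`, and
`m a α` the multiplicity of the resonance `α·|χ(a)|` of index `k`:
the number of pairs `(I,J)` with `I ⊆ {1,…,r(a)}` (indices `< r a`),
`J ⊆ {r(a)+1,…,n}` (indices `≥ r a`), `|J| - |I| = k - r(a)` and `αⱼ ≥ 1`
for all `j ∈ I ∪ J`.  Then the number of resonances of index `k` of modulus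
at most `Λ`, counted with multiplicity, is
`Λⁿ/(k!(n-k)!) · ∑ₐ (∏ⱼ χⱼ(a))⁻¹ + O(Λ^{n-1})` as `Λ → +∞`. -/
theorem weyl_law_morse_smale
    (n k : ℕ) (hn : 1 ≤ n) (hk : k ≤ n)
    (A : Type*) [Fintype A]
    (r : A → ℕ) (hr : ∀ a, r a ≤ n)
    (χ : A → Fin n → ℝ) (hχ : ∀ a j, 0 < χ a j)
    (m : A → (Fin n → ℕ) → ℕ)
    (hm : ∀ a α, m a α = Nat.card {p : Finset (Fin n) × Finset (Fin n) |
        (∀ j ∈ p.1, (j : ℕ) < r a) ∧ (∀ j ∈ p.2, r a ≤ (j : ℕ)) ∧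
        (p.2.card : ℤ) - (p.1.card : ℤ) = (k : ℤ) - (r a : ℤ) ∧
        ∀ j ∈ p.1 ∪ p.2, 1 ≤ α j}) :
    ∃ C : ℝ, 0 ≤ C ∧ ∃ Λ₀ : ℝ, ∀ Λ : ℝ, Λ₀ ≤ Λ →
      |(∑ a : A, ∑' α : Fin n → ℕ,
            (if ∑ j, (α j : ℝ) * χ a j ≤ Λ then (m a α : ℝ) else 0))
          - Λ ^ n / (k.factorial * (n - k).factorial)
              * ∑ a : A, (∏ j, χ a j)⁻¹|
        ≤ C * Λ ^ (n - 1) := by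
  have hle : ∀ a α, m a α ≤ n.choose k := by
    intro a α
    rw [hm, ← card_index_pairs (k := k) (hr a), Nat.card_coe_set_eq, Nat.card_coe_set_eq]
    exact Set.ncard_le_ncard (fun p hp => ⟨hp.1, hp.2.1, hp.2.2.1⟩) (Set.toFinite _)
  have heq : ∀ a α, (∀ j, 1 ≤ α j) → m a α = n.choose k := by
    intro a α hα
    rw [hm, ← card_index_pairs (k := k) (hr a)]
    simp only [hα, implies_true, and_true]
  choose C hC hbound using fun a =>
    simplexLattice.exists_abs_tsum_sub_le (hχ a) (m a) (n.choose k) (hle a) (heq a)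
  refine ⟨∑ a, C a, Finset.sum_nonneg fun a _ => hC a, ∑ a, ∑ j, χ a j, fun Λ hΛ => ?_⟩
  have hcoef : Λ ^ n / (k.factorial * (n - k).factorial) =
      n.choose k * Λ ^ n / n.factorial := by
    rw [Nat.cast_choose ℝ hk]
    field_simp
  rw [hcoef, Finset.mul_sum, ← Finset.sum_sub_distrib, Finset.sum_mul]
  refine (Finset.abs_sum_le_sum_abs _ _).trans (Finset.sum_le_sum fun a _ => hbound a Λ ?_)
  exact (Finset.single_le_sum (f := fun a => ∑ j, χ a j)
    (fun b _ => Finset.sum_nonneg fun j _ => (hχ b j).le) (Finset.mem_univ a)).trans hΛ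
end

section
/- Let I ⊆ ℝ be a countable set that is bounded below by d ∈ ℝ and has no accumulation points, and let h : (0,1] → ℝ be a C^∞ function admitting a polyhomogeneous asymptotic expansion indexed by I with coefficients (a_λ)_{λ∈I}. Then there exists a function F : ℂ → ℂ such that: (i) F(z) = ∫₀¹ h(s) s^{z−1} ds for every z with Re z > −d (the integral being absolutely convergent there); (ii) F is analytic at every point z₀ ∉ −I := {−λ : λ ∈ I}; and (iii) for every λ ∈ I, the function z ↦ (z + λ)·F(z) extends analytically across −λ, i.e. F has at worst a simple pole at each point of −I. -/
open MeasureTheory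

open Set Filter Topology

/-- A set of reals that is bounded below and has no accumulation point has finitely many elements
below any given bound. -/
lemma finite_inter_Iic_of_not_accPt {I : Set ℝ} {d : ℝ} (hbdd : I ⊆ Ici d)
    (hdisc : ∀ x : ℝ, ¬ AccPt x (𝓟 I)) (L : ℝ) : {x ∈ I | x ≤ L}.Finite := by
  by_contra hinf
  obtain ⟨x, -, hx⟩ := Set.Infinite.exists_accPt_of_subset_isCompact hinf
    (isCompact_Icc (a := d) (b := L)) (fun x hx => ⟨hbdd hx.1, hx.2⟩)
  exact hdisc x (hx.mono (principal_mono.2 fun y hy => hy.1))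

/-- The Mellin transform of a continuous function on `(0,1]` that is `O(s ^ L)` converges and is
differentiable on the half-plane `-L < Re z`. -/
lemma mellin_indicator_Ioc_of_bound {g : ℝ → ℂ} {C L : ℝ} (hg : ContinuousOn g (Ioc 0 1))
    (hC : ∀ s ∈ Ioc (0 : ℝ) 1, ‖g s‖ ≤ C * s ^ L) {z : ℂ} (hz : -L < z.re) :
    MellinConvergent ((Ioc 0 1).indicator g) z ∧
      DifferentiableAt ℂ (mellin ((Ioc 0 1).indicator g)) z := by
  have hmeas : AEStronglyMeasurable ((Ioc 0 1).indicator g) (volume.restrict (Ioi (0 : ℝ))) :=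
    ((aestronglyMeasurable_indicator_iff measurableSet_Ioc).2
      (hg.aestronglyMeasurable measurableSet_Ioc)).restrict
  have hbound : ∀ s ∈ Ioi (0 : ℝ), ‖(Ioc 0 1).indicator g s‖ ≤ ‖C * s ^ L‖ := by
    intro s hs
    by_cases h1 : s ∈ Ioc (0 : ℝ) 1
    · rw [indicator_of_mem h1]
      exact (hC s h1).trans (le_abs_self _)
    · rw [indicator_of_notMem h1, norm_zero]
      positivity
  have hpow : ContinuousOn (fun s : ℝ => C * s ^ L) (Ioi 0) :=
    continuousOn_const.mul
      (continuousOn_id.rpow_const fun x (hx : 0 < x) => Or.inl hx.ne')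
  have hloc : LocallyIntegrableOn ((Ioc 0 1).indicator g) (Ioi 0) := by
    refine (hpow.locallyIntegrableOn measurableSet_Ioi).mono
      ((aestronglyMeasurable_indicator_iff measurableSet_Ioc).2
        (hg.aestronglyMeasurable measurableSet_Ioc)) ?_
    refine .of_forall fun s => ?_
    by_cases h1 : s ∈ Ioc (0 : ℝ) 1
    · exact hbound s h1.1
    · rw [indicator_of_notMem h1, norm_zero]
      positivity
  have htop : (Ioc 0 1).indicator g =O[atTop] fun s : ℝ => s ^ (-(z.re + 1)) := by
    refine Asymptotics.IsBigO.of_bound 0 ?_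
    filter_upwards [eventually_gt_atTop (1 : ℝ)] with s hs
    rw [indicator_of_notMem fun h => hs.not_ge h.2, norm_zero, zero_mul]
  have hbot : (Ioc 0 1).indicator g =O[𝓝[>] 0] fun s : ℝ => s ^ (-(-L)) := by
    refine Asymptotics.IsBigO.of_bound |C| ?_
    filter_upwards [self_mem_nhdsWithin] with s hs
    simpa only [norm_mul, Real.norm_eq_abs, neg_neg] using hbound s hs
  exact ⟨mellinConvergent_of_isBigO_rpow hloc htop (lt_add_one _) hbot hz,
    mellin_differentiableAt_of_isBigO_rpow hloc htop (lt_add_one _) hbot hz⟩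

/-- Adding a finite combination of powers to a function on `(0,1]` adds the corresponding simple
fractions to its Mellin transform. -/
lemma hasMellin_indicator_Ioc_add_sum_cpow (a : ℝ → ℝ) (T : Finset ℝ) {g : ℝ → ℂ} {z : ℂ}
    (hg : MellinConvergent ((Ioc 0 1).indicator g) z) (hT : ∀ μ ∈ T, 0 < z.re + μ) :
    HasMellin ((Ioc 0 1).indicator fun s : ℝ => g s + ∑ μ ∈ T, (a μ : ℂ) * (s : ℂ) ^ (μ : ℂ)) z
      (mellin ((Ioc 0 1).indicator g) z + ∑ μ ∈ T, (a μ : ℂ) * (1 / (z + μ))) := by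
  induction T using Finset.induction_on with
  | empty => simpa [HasMellin] using hg
  | insert ν T hν ih =>
    have h₁ := ih fun μ hμ => hT μ (Finset.mem_insert_of_mem hμ)
    have h₂ := hasMellin_cpow_Ioc (ν : ℂ) (s := z)
      (by simpa using hT ν (Finset.mem_insert_self _ _))
    have h₃ := h₂.1.const_smul (a ν : ℂ)
    have h₄ := hasMellin_add h₁.1 h₃
    rw [mellin_const_smul, h₁.2, h₂.2] at h₄
    convert h₄ using 1
    · ext s
      by_cases hs : s ∈ Ioc (0 : ℝ) 1
      · simp only [indicator_of_mem hs, Finset.sum_insert hν, smul_eq_mul]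
        ring
      · simp [indicator_of_notMem hs]
    · rw [Finset.sum_insert hν, smul_eq_mul]
      ring

/-- The Mellin transform of `g · 1_{(0,1]}` as an integral over `(0,1]`. -/
lemma hasMellin_indicator_Ioc_iff {g : ℝ → ℂ} {z m : ℂ} :
    HasMellin ((Ioc 0 1).indicator g) z m ↔
      IntegrableOn (fun s : ℝ => g s * (s : ℂ) ^ (z - 1)) (Ioc 0 1) ∧
        ∫ s in Ioc (0 : ℝ) 1, g s * (s : ℂ) ^ (z - 1) = m := by
  simp_rw [HasMellin, mellin, MellinConvergent, ← indicator_smul, IntegrableOn,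
    integrable_indicator_iff measurableSet_Ioc, integral_indicator measurableSet_Ioc,
    IntegrableOn, Measure.restrict_restrict_of_subset Ioc_subset_Ioi_self, smul_eq_mul, mul_comm]

/-- **Meromorphic continuation of the Mellin transform of a polyhomogeneous
function.** Let `I ⊆ ℝ` be countable, contained in `[d,∞)` and without
accumulation points, and let `h : (0,1] → ℝ` be smooth with a polyhomogeneous
asymptotic expansion indexed by `I` with coefficients `(a_λ)`.  Then there is
`F : ℂ → ℂ` which (i) equals the (absolutely convergent) Mellin transform
`∫₀¹ h(s) s^{z-1} ds` for `Re z > -d`, (ii) is analytic at every point not in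
`-I`, and (iii) has at worst a simple pole at each `-λ`, `λ ∈ I`: the function
`z ↦ (z+λ)·F(z)` extends analytically across `-λ`. -/
theorem mellin_meromorphic_continuation_of_polyhomogeneous
    (I : Set ℝ) (d : ℝ) (hcount : I.Countable) (hbdd : I ⊆ Set.Ici d)
    (hdisc : ∀ x : ℝ, ¬ AccPt x (Filter.principal I))
    (h : ℝ → ℝ) (hsmooth : ContDiffOn ℝ (⊤ : ℕ∞) h (Set.Ioc 0 1))
    (a : ℝ → ℝ)
    (hexp : ∀ Λ : ℝ, ∃ C : ℝ, 0 ≤ C ∧ ∀ s ∈ Set.Ioc (0 : ℝ) 1,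
      |h s - ∑ᶠ μ ∈ {x ∈ I | x ≤ Λ}, a μ * s ^ μ| ≤ C * s ^ Λ) :
    ∃ F : ℂ → ℂ,
      (∀ z : ℂ, -d < z.re →
        IntegrableOn (fun s : ℝ => (h s : ℂ) * (s : ℂ) ^ (z - 1)) (Set.Ioc 0 1) ∧
        F z = ∫ s in Set.Ioc (0 : ℝ) 1, (h s : ℂ) * (s : ℂ) ^ (z - 1)) ∧
      (∀ z₀ : ℂ, (∀ lam ∈ I, z₀ ≠ -(lam : ℂ)) → AnalyticAt ℂ F z₀) ∧
      (∀ lam ∈ I, ∃ G : ℂ → ℂ, AnalyticAt ℂ G (-(lam : ℂ)) ∧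
        ∀ z : ℂ, z ≠ -(lam : ℂ) → G z = (z + (lam : ℂ)) * F z) := by
  choose T hT using fun L : ℝ =>
    (finite_inter_Iic_of_not_accPt hbdd hdisc L).exists_finset
  choose C _ hC using hexp
  let k : ℝ → ℝ → ℂ := fun L s => (h s : ℂ) - ∑ μ ∈ T L, (a μ : ℂ) * (s : ℂ) ^ (μ : ℂ)
  have hk_cont (L : ℝ) : ContinuousOn (k L) (Ioc 0 1) := by
    refine (Complex.continuous_ofReal.comp_continuousOn hsmooth.continuousOn).sub
      (continuousOn_finsetSum _ fun μ _ => continuousOn_const.mul ?_)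
    exact Complex.continuous_ofReal.continuousOn.cpow_const fun s hs =>
      Complex.ofReal_mem_slitPlane.2 hs.1
  have hk_bound (L : ℝ) : ∀ s ∈ Ioc (0 : ℝ) 1, ‖k L s‖ ≤ C L * s ^ L := by
    intro s hs
    have hsum : ∑ᶠ μ ∈ {x ∈ I | x ≤ L}, a μ * s ^ μ = ∑ μ ∈ T L, a μ * s ^ μ := by
      have : {x ∈ I | x ≤ L} = (T L : Set ℝ) := by
        ext x
        exact (hT L x).symm
      rw [this, finsum_mem_coe_finset]
    have hreal : k L s = ((h s - ∑ μ ∈ T L, a μ * s ^ μ : ℝ) : ℂ) := by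
      simp only [k, Complex.ofReal_sub, Complex.ofReal_sum, Complex.ofReal_mul,
        Complex.ofReal_cpow hs.1.le]
    rw [hreal, Complex.norm_real, Real.norm_eq_abs, ← hsum]
    exact hC L s hs
  have hk (L : ℝ) {z : ℂ} (hz : -L < z.re) :=
    mellin_indicator_Ioc_of_bound (hk_cont L) (hk_bound L) hz
  let Φ : ℝ → ℂ → ℂ := fun L z =>
    mellin ((Ioc 0 1).indicator (k L)) z + ∑ μ ∈ T L, (a μ : ℂ) * (1 / (z + μ))
  have hΦ_le {L L' : ℝ} (hL : L ≤ L') {z : ℂ} (hz : -L < z.re) : Φ L z = Φ L' z := by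
    have hsub : T L ⊆ T L' := fun μ hμ =>
      (hT L' μ).2 ⟨((hT L μ).1 hμ).1, ((hT L μ).1 hμ).2.trans hL⟩
    have hadd := hasMellin_indicator_Ioc_add_sum_cpow a (T L' \ T L)
      (hk L' (z := z) (by linarith)).1 (by
        intro μ hμ
        rw [Finset.mem_sdiff] at hμ
        have : ¬ μ ≤ L := fun hle => hμ.2 ((hT L μ).2 ⟨((hT L' μ).1 hμ.1).1, hle⟩)
        linarith)
    have hkeq : k L = fun s : ℝ => k L' s + ∑ μ ∈ T L' \ T L, (a μ : ℂ) * (s : ℂ) ^ (μ : ℂ) := by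
      ext s
      simp only [k]
      rw [← Finset.sum_sdiff hsub]
      ring
    simp only [Φ]
    rw [hkeq, hadd.2, add_assoc, Finset.sum_sdiff hsub]
  let F : ℂ → ℂ := fun z => Φ (1 - z.re) z
  have hF {L : ℝ} {z : ℂ} (hz : -L < z.re) : F z = Φ L z := by
    rcases le_total L (1 - z.re) with hL | hL
    · exact (hΦ_le hL hz).symm
    · exact hΦ_le hL (by linarith)
  have hF_near {L : ℝ} {z₀ : ℂ} (hz : -L < z₀.re) : F =ᶠ[𝓝 z₀] Φ L := by
    filter_upwards [(isOpen_lt continuous_const Complex.continuous_re).mem_nhds hz] with z hz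
    exact hF hz
  have hM (L : ℝ) {z₀ : ℂ} (hz : -L < z₀.re) :
      AnalyticAt ℂ (mellin ((Ioc 0 1).indicator (k L))) z₀ := by
    rw [Complex.analyticAt_iff_eventually_differentiableAt]
    filter_upwards [(isOpen_lt continuous_const Complex.continuous_re).mem_nhds hz] with z hz
    exact (hk L hz).2
  have hfrac (S : Finset ℝ) {z₀ : ℂ} (hz : ∀ μ ∈ S, z₀ ≠ -(μ : ℂ)) :
      AnalyticAt ℂ (fun z : ℂ => ∑ μ ∈ S, (a μ : ℂ) * (1 / (z + μ))) z₀ :=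
    Finset.analyticAt_fun_sum _ fun μ hμ => analyticAt_const.mul <|
      analyticAt_const.div (analyticAt_id.add analyticAt_const)
        fun h0 => hz μ hμ (eq_neg_of_add_eq_zero_left h0)
  refine ⟨F, fun z hz => ?_, fun z₀ hz₀ => ?_, fun lam hlam => ?_⟩
  · have hadd := hasMellin_indicator_Ioc_add_sum_cpow a (T d) (hk d hz).1 (by
      intro μ hμ
      have : d ≤ μ := hbdd ((hT d μ).1 hμ).1
      linarith)
    simp only [k, sub_add_cancel] at hadd
    rw [hasMellin_indicator_Ioc_iff] at hadd
    exact ⟨hadd.1, (hF hz).trans hadd.2.symm⟩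
  · have hz : -(1 - z₀.re) < z₀.re := by linarith
    refine AnalyticAt.congr ?_ (hF_near hz).symm
    exact (hM _ hz).add (hfrac _ fun μ hμ => hz₀ μ ((hT _ μ).1 hμ).1)
  · have hz : -(lam + 1) < (-(lam : ℂ)).re := by simp
    have hmem : lam ∈ T (lam + 1) := (hT _ _).2 ⟨hlam, by linarith⟩
    let H : ℂ → ℂ := fun z => (z + lam) * (mellin ((Ioc 0 1).indicator (k (lam + 1))) z +
      ∑ μ ∈ (T (lam + 1)).erase lam, (a μ : ℂ) * (1 / (z + μ))) + a lam
    have hH : AnalyticAt ℂ H (-(lam : ℂ)) := by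
      refine ((analyticAt_id.add analyticAt_const).mul
        ((hM _ hz).add (hfrac _ fun μ hμ heq => ?_))).add analyticAt_const
      exact Finset.ne_of_mem_erase hμ (by exact_mod_cast (neg_injective heq).symm)
    refine ⟨Function.update (fun z => (z + lam) * F z) (-(lam : ℂ)) (a lam), hH.congr ?_,
      fun z hne => Function.update_of_ne hne _ _⟩
    filter_upwards [hF_near hz] with z hFz
    rcases eq_or_ne z (-(lam : ℂ)) with rfl | hne
    · simp [H]
    · have hne' : z + lam ≠ 0 := fun h0 => hne (eq_neg_of_add_eq_zero_left h0)
      rw [Function.update_of_ne hne, hFz]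
      simp only [H, Φ]
      rw [← Finset.add_sum_erase _ _ hmem]
      field_simp
      ring
end
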